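/- (Coercive property) The cost function J is coercive: for any sequence (K_i)_{i≥1} of stabilizing gain matrices, if ‖K_i‖ → +∞ or ρ(A − B K_i) → 1, then J(K_i) → +∞. -/

import Mathlib

open Matrix Filter

/-- Spectral radius of a real square matrix: the largest modulus of a complex eigenvalue. -/
noncomputable def specRad {n : ℕ} (M : Matrix (Fin n) (Fin n) ℝ) : ℝ :=
  sSup ((fun z : ℂ => ‖z‖) '' spectrum ℂ (M.map Complex.ofReal))

/-- Spectral (ℓ2-operator) norm of a real matrix. -/
noncomputable def spNorm {m n : ℕ} (M : Matrix (Fin m) (Fin n) ℝ) : ℝ :=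
  ‖LinearMap.toContinuousLinearMap (Matrix.toEuclideanLin M)‖

/-- A positive definite matrix dominates a positive multiple of the identity. -/
lemma aux_lower {n : ℕ} (hn : 1 ≤ n) (P : Matrix (Fin n) (Fin n) ℝ) (hP : P.PosDef) :
    ∃ c : ℝ, 0 < c ∧ (P - c • (1 : Matrix (Fin n) (Fin n) ℝ)).PosSemidef := by
  have : Nonempty (Fin n) := ⟨⟨0, hn⟩⟩
  obtain ⟨i0, hi0⟩ := Finite.exists_min hP.1.eigenvalues
  refine ⟨hP.1.eigenvalues i0, hP.eigenvalues_pos i0, ?_⟩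
  set c := hP.1.eigenvalues i0 with hc
  have h := hP.1.spectral_theorem
  rw [Unitary.conjStarAlgAut_apply] at h
  have h1 : (1 : Matrix (Fin n) (Fin n) ℝ) = (hP.1.eigenvectorUnitary : Matrix (Fin n) (Fin n) ℝ)
      * star (hP.1.eigenvectorUnitary : Matrix (Fin n) (Fin n) ℝ) := by simp
  have h2 : P - c • (1 : Matrix (Fin n) (Fin n) ℝ) =
      (hP.1.eigenvectorUnitary : Matrix (Fin n) (Fin n) ℝ)
      * diagonal (fun i => hP.1.eigenvalues i - c)
      * (hP.1.eigenvectorUnitary : Matrix (Fin n) (Fin n) ℝ)ᴴ := by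
    have h3 : diagonal (fun i => hP.1.eigenvalues i - c) =
      diagonal (RCLike.ofReal ∘ hP.1.eigenvalues) - c • (1 : Matrix (Fin n) (Fin n) ℝ) := by
      ext i j
      by_cases hij : i = j <;> simp [hij, diagonal]
    rw [h3, mul_sub, sub_mul, ← star_eq_conjTranspose, mul_smul_comm, smul_mul_assoc, mul_one, ← h1]
    congr 1
  rw [h2]
  exact (PosSemidef.diagonal (fun i => sub_nonneg.2 (hi0 i))).mul_mul_conjTranspose_same _

lemma aux_factor {n : ℕ} (P : Matrix (Fin n) (Fin n) ℝ) (hP : P.PosSemidef) :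
    ∃ S : Matrix (Fin n) (Fin n) ℝ, P = Sᵀ * S := by
  open scoped MatrixOrder in
  obtain ⟨S, hS⟩ := CStarAlgebra.nonneg_iff_eq_star_mul_self.mp hP.nonneg
  exact ⟨S, by rw [hS, star_eq_conjTranspose, conjTranspose_eq_transpose_of_trivial]⟩

lemma aux_trace_nonneg {n : ℕ} (P E : Matrix (Fin n) (Fin n) ℝ) (hP : P.PosSemidef)
    (hE : E.PosSemidef) : 0 ≤ (P * E).trace := by
  obtain ⟨S, rfl⟩ := aux_factor P hP
  rw [mul_assoc, trace_mul_comm]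
  have := (hE.mul_mul_conjTranspose_same S).trace_nonneg
  rwa [conjTranspose_eq_transpose_of_trivial] at this

lemma aux_trace_le {n : ℕ} (P E : Matrix (Fin n) (Fin n) ℝ) (c : ℝ) (hP : P.PosSemidef)
    (hE : (E - c • (1 : Matrix (Fin n) (Fin n) ℝ)).PosSemidef) :
    c * P.trace ≤ (P * E).trace := by
  have := aux_trace_nonneg P _ hP hE
  simp [mul_sub, trace_sub, trace_smul] at this
  exact this

lemma aux_frob {m n : ℕ} (M : Matrix (Fin m) (Fin n) ℝ) (v : Fin n → ℝ) :
    (M *ᵥ v) ⬝ᵥ (M *ᵥ v) ≤ (Mᵀ * M).trace * (v ⬝ᵥ v) := by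
  have h : (Mᵀ * M).trace = ∑ i, ∑ j, M i j ^ 2 := by
    rw [trace_mul_comm]
    simp [trace, mul_apply, sq]
  rw [h, Finset.sum_mul]
  simp only [dotProduct, mulVec]
  refine Finset.sum_le_sum fun i _ => ?_
  have := Finset.sum_mul_sq_le_sq_mul_sq Finset.univ (fun j => M i j) v
  simpa [sq] using this

lemma aux_quad_le {n : ℕ} (P : Matrix (Fin n) (Fin n) ℝ) (hP : P.PosSemidef) (v : Fin n → ℝ) :
    v ⬝ᵥ (P *ᵥ v) ≤ P.trace * (v ⬝ᵥ v) := by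
  obtain ⟨S, rfl⟩ := aux_factor P hP
  have := aux_frob S v
  rwa [← mulVec_mulVec, dotProduct_mulVec, vecMul_transpose]

lemma aux_spNorm {m n : ℕ} (M : Matrix (Fin m) (Fin n) ℝ) :
    spNorm M ^ 2 ≤ (Mᵀ * M).trace := by
  have h0 : 0 ≤ (Mᵀ * M).trace := by
    have := (posSemidef_conjTranspose_mul_self M).trace_nonneg
    rwa [conjTranspose_eq_transpose_of_trivial] at this
  have : spNorm M ≤ Real.sqrt (Mᵀ * M).trace := by
    refine ContinuousLinearMap.opNorm_le_bound _ (Real.sqrt_nonneg _) fun x => ?_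
    have h := aux_frob M x.ofLp
    have e1 : ‖x‖ = Real.sqrt (x.ofLp ⬝ᵥ x.ofLp) := by
      rw [EuclideanSpace.norm_eq]; simp [dotProduct, sq]
    have e2 : ‖toEuclideanLin M x‖ = Real.sqrt ((M *ᵥ x.ofLp) ⬝ᵥ (M *ᵥ x.ofLp)) := by
      rw [EuclideanSpace.norm_eq]; simp [dotProduct, sq, toLpLin_apply]
    change ‖toEuclideanLin M x‖ ≤ _
    rw [e1, e2, ← Real.sqrt_mul h0]
    exact Real.sqrt_le_sqrt h
  calc spNorm M ^ 2 ≤ Real.sqrt (Mᵀ * M).trace ^ 2 := by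
        apply pow_le_pow_left₀ _ this
        exact norm_nonneg _
    _ = _ := Real.sq_sqrt h0

/-- The spectral radius is attained at a (real and imaginary part of a) left eigenvector. -/
lemma aux_eig {n : ℕ} (hn : 1 ≤ n) (M : Matrix (Fin n) (Fin n) ℝ) :
    ∃ (a b : ℝ) (x y : Fin n → ℝ), specRad M ^ 2 = a ^ 2 + b ^ 2 ∧ 0 < x ⬝ᵥ x + y ⬝ᵥ y ∧
      Mᵀ *ᵥ x = a • x - b • y ∧ Mᵀ *ᵥ y = b • x + a • y := by
  have : Nonempty (Fin n) := ⟨⟨0, hn⟩⟩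
  have hne : (spectrum ℂ (M.map Complex.ofReal)).Nonempty :=
    spectrum.nonempty_of_isAlgClosed_of_finiteDimensional ℂ _
  have hfin : (spectrum ℂ (M.map Complex.ofReal)).Finite := Matrix.finite_spectrum _
  have hmem := (hne.image (fun z : ℂ => ‖z‖)).csSup_mem (hfin.image _)
  obtain ⟨z, hz, hzr⟩ := hmem
  change ‖z‖ = specRad M at hzr
  rw [spectrum.mem_iff, Matrix.isUnit_iff_isUnit_det, isUnit_iff_ne_zero, not_not] at hz
  obtain ⟨v, hv, hvz⟩ := Matrix.exists_vecMul_eq_zero_iff.2 hz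
  have key : ∀ j, ∑ i, v i * (M i j : ℂ) = z * v j := by
    intro j
    have := congrFun hvz j
    rw [vecMul_sub, Pi.sub_apply, Pi.zero_apply, sub_eq_zero, Algebra.algebraMap_eq_smul_one, vecMul_smul,
      vecMul_one] at this
    simpa [vecMul, dotProduct] using this.symm
  refine ⟨z.re, z.im, fun i => (v i).re, fun i => (v i).im, ?_, ?_, ?_, ?_⟩
  · rw [← hzr, Complex.sq_norm, Complex.normSq_apply]; ring
  · obtain ⟨i, hi⟩ := Function.ne_iff.1 hv
    have : 0 < Complex.normSq (v i) := Complex.normSq_pos.2 hi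
    rw [dotProduct, dotProduct, ← Finset.sum_add_distrib]
    exact Finset.sum_pos' (fun i _ => by nlinarith [sq_nonneg (v i).re, sq_nonneg (v i).im])
      ⟨i, Finset.mem_univ _, by rwa [Complex.normSq_apply] at this⟩
  · ext j
    have := congrArg Complex.re (key j)
    simp only [Complex.re_sum, Complex.mul_re, Complex.ofReal_re, Complex.ofReal_im, mul_zero,
      sub_zero] at this
    simpa [mulVec, dotProduct, mul_comm] using this
  · ext j
    have := congrArg Complex.im (key j)
    simp only [Complex.im_sum, Complex.mul_im, Complex.ofReal_re, Complex.ofReal_im, mul_zero,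
      zero_add] at this
    have h2 : z.im * (v j).re + z.re * (v j).im = z.re * (v j).im + z.im * (v j).re := by ring
    simp only [mulVec, dotProduct, transpose_apply, Pi.add_apply, Pi.smul_apply, smul_eq_mul, h2,
      ← this]
    exact Finset.sum_congr rfl fun i _ => by ring

lemma aux_rad {n : ℕ} (hn : 1 ≤ n) (M D S : Matrix (Fin n) (Fin n) ℝ) (c : ℝ)
    (hD : D.PosSemidef) (hS : (S - c • (1 : Matrix (Fin n) (Fin n) ℝ)).PosSemidef)
    (h : D = S + M * D * Mᵀ) (hr : specRad M < 1) :
    c ≤ (1 - specRad M ^ 2) * D.trace := by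
  have hr0 : 0 ≤ specRad M := Real.sSup_nonneg (by rintro _ ⟨z, _, rfl⟩; exact norm_nonneg z)
  obtain ⟨a, b, x, y, hab, hpos, hx, hy⟩ := aux_eig hn M
  have hq : ∀ v : Fin n → ℝ, v ⬝ᵥ (D *ᵥ v) =
      v ⬝ᵥ (S *ᵥ v) + (Mᵀ *ᵥ v) ⬝ᵥ (D *ᵥ (Mᵀ *ᵥ v)) := by
    intro v
    conv_lhs => rw [h]
    rw [add_mulVec, dotProduct_add, ← mulVec_mulVec, ← mulVec_mulVec, dotProduct_mulVec v M,
      mulVec_transpose]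
  have hl : ∀ v : Fin n → ℝ, c * (v ⬝ᵥ v) ≤ v ⬝ᵥ (S *ᵥ v) := by
    intro v
    have := hS.dotProduct_mulVec_nonneg v
    simp [sub_mulVec, dotProduct_sub, smul_mulVec] at this
    linarith
  have e1 := hq x
  have e2 := hq y
  rw [hx] at e1
  rw [hy] at e2
  simp only [mulVec_sub, mulVec_add, mulVec_smul, dotProduct_sub, dotProduct_add, sub_dotProduct,
    add_dotProduct, dotProduct_smul, smul_dotProduct, smul_eq_mul] at e1 e2
  have u1 := aux_quad_le D hD x
  have u2 := aux_quad_le D hD y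
  have l1 := hl x
  have l2 := hl y
  have e3 : (1 - specRad M ^ 2) * (x ⬝ᵥ (D *ᵥ x) + y ⬝ᵥ (D *ᵥ y)) =
      x ⬝ᵥ (S *ᵥ x) + y ⬝ᵥ (S *ᵥ y) := by rw [hab]; linarith
  have hp : 0 ≤ 1 - specRad M ^ 2 := by nlinarith
  have : (1 - specRad M ^ 2) * (x ⬝ᵥ (D *ᵥ x) + y ⬝ᵥ (D *ᵥ y)) ≤
     (1 - specRad M ^ 2) * (D.trace * (x ⬝ᵥ x + y ⬝ᵥ y)) :=
    mul_le_mul_of_nonneg_left (by linarith) hp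
  refine le_of_mul_le_mul_right ?_ hpos
  linarith

/-- Coercive property: along any sequence of stabilizing gains `K i` with
`‖K i‖ → ∞` or `ρ(A − B K i) → 1`, the LQR cost `J(K i)` tends to `+∞`. -/
theorem cost_coercive {d k : ℕ} (hd : 1 ≤ d) (hk : 1 ≤ k)
    (A : Matrix (Fin d) (Fin d) ℝ) (B : Matrix (Fin d) (Fin k) ℝ)
    (Q : Matrix (Fin d) (Fin d) ℝ) (R : Matrix (Fin k) (Fin k) ℝ)
    (D0 : Matrix (Fin d) (Fin d) ℝ) (σ : ℝ) (hσ : 0 < σ)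
    (hQ : Q.PosDef) (hR : R.PosDef) (hD0 : D0.PosDef)
    (K : ℕ → Matrix (Fin k) (Fin d) ℝ)
    (hstab : ∀ i, specRad (A - B * K i) < 1)
    (D : ℕ → Matrix (Fin d) (Fin d) ℝ)
    (hD : ∀ i, (D i).PosDef)
    (hDeq : ∀ i, D i = (D0 + σ ^ 2 • (B * Bᵀ)) + (A - B * K i) * D i * (A - B * K i)ᵀ)
    (hdiv : Tendsto (fun i => spNorm (K i)) atTop atTop ∨
            Tendsto (fun i => specRad (A - B * K i)) atTop (nhds 1)) :
    Tendsto (fun i => ((Q + (K i)ᵀ * R * K i) * D i).trace + σ ^ 2 * R.trace) atTop atTop := by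
  obtain ⟨c, hc, hcD⟩ := aux_lower hd D0 hD0
  obtain ⟨q, hq, hqQ⟩ := aux_lower hd Q hQ
  obtain ⟨r, hr, hrR⟩ := aux_lower hk R hR
  have hS : (D0 + σ ^ 2 • (B * Bᵀ) - c • (1 : Matrix (Fin d) (Fin d) ℝ)).PosSemidef := by
    have h1 := (posSemidef_self_mul_conjTranspose B).smul (sq_nonneg σ)
    rw [conjTranspose_eq_transpose_of_trivial] at h1
    have := hcD.add h1
    rwa [sub_add_eq_add_sub] at this
  have hDc : ∀ i, (D i - c • (1 : Matrix (Fin d) (Fin d) ℝ)).PosSemidef := by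
    intro i
    have h1 := (hD i).posSemidef.mul_mul_conjTranspose_same (A - B * K i)
    rw [conjTranspose_eq_transpose_of_trivial] at h1
    have := hS.add h1
    rwa [sub_add_eq_add_sub, ← hDeq i] at this
  have hKRK : ∀ i, ((K i)ᵀ * R * K i).PosSemidef := by
    intro i
    have h1 := hR.posSemidef.conjTranspose_mul_mul_same (K i)
    rwa [conjTranspose_eq_transpose_of_trivial] at h1
  have hRt : 0 ≤ σ ^ 2 * R.trace := mul_nonneg (sq_nonneg σ) hR.posSemidef.trace_nonneg
  have hsplit : ∀ i, ((Q + (K i)ᵀ * R * K i) * D i).trace =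
      (Q * D i).trace + ((K i)ᵀ * R * K i * D i).trace := by
    intro i; rw [add_mul, trace_add]
  rcases hdiv with hdiv | hdiv
  · have hlow : ∀ i, c * r * spNorm (K i) ^ 2 ≤
        ((Q + (K i)ᵀ * R * K i) * D i).trace + σ ^ 2 * R.trace := by
      intro i
      have h1 := aux_trace_nonneg Q (D i) hQ.posSemidef (hD i).posSemidef
      have h2 := aux_trace_le _ _ c (hKRK i) (hDc i)
      have h3 := aux_spNorm (K i)
      have h4 : r * ((K i)ᵀ * K i).trace ≤ ((K i)ᵀ * R * K i).trace := by
        have hp := posSemidef_self_mul_conjTranspose (K i)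
        rw [conjTranspose_eq_transpose_of_trivial] at hp
        have := aux_trace_le _ R r hp hrR
        rw [trace_mul_comm (K i) (K i)ᵀ, Matrix.mul_assoc, trace_mul_comm (K i)] at this
        exact this
      have h5 : c * (r * spNorm (K i) ^ 2) ≤ c * ((K i)ᵀ * R * K i).trace :=
        mul_le_mul_of_nonneg_left ((mul_le_mul_of_nonneg_left h3 hr.le).trans h4) hc.le
      rw [hsplit]
      linarith
    refine tendsto_atTop_mono hlow ?_
    exact ((tendsto_pow_atTop two_ne_zero).comp hdiv).const_mul_atTop (mul_pos hc hr)
  · have hr0 : ∀ i, 0 ≤ specRad (A - B * K i) := fun i =>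
      Real.sSup_nonneg (by rintro _ ⟨z, _, rfl⟩; exact norm_nonneg z)
    have hpos : ∀ i, 0 < 1 - specRad (A - B * K i) ^ 2 := fun i => by
      nlinarith [hr0 i, hstab i]
    have hlow : ∀ i, (q * c) * (1 - specRad (A - B * K i) ^ 2)⁻¹ ≤
        ((Q + (K i)ᵀ * R * K i) * D i).trace + σ ^ 2 * R.trace := by
      intro i
      have h1 := aux_trace_nonneg _ (D i) (hKRK i) (hD i).posSemidef
      have h2 := aux_trace_le _ _ q (hD i).posSemidef hqQ
      rw [trace_mul_comm] at h2
      have h3 := aux_rad hd _ _ _ c (hD i).posSemidef hS (hDeq i) (hstab i)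
      have h4 : c * (1 - specRad (A - B * K i) ^ 2)⁻¹ ≤ (D i).trace := by
        rw [← div_eq_mul_inv, div_le_iff₀ (hpos i)]
        linarith
      have h5 := mul_le_mul_of_nonneg_left h4 hq.le
      rw [hsplit]
      linarith
    refine tendsto_atTop_mono hlow ?_
    refine Tendsto.const_mul_atTop (mul_pos hq hc) ?_
    refine tendsto_inv_nhdsGT_zero.comp ?_
    refine tendsto_nhdsWithin_iff.2 ⟨?_, Eventually.of_forall hpos⟩
    have := (hdiv.pow 2).const_sub 1
    simpa using this
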